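/- Let P ⊆ ℝ² be a set, let k ≥ 1 be a natural number, and let W ⊆ P be a set of k+1 distinct points. Suppose there exists a point g ∈ P such that g ∈ V(w) for every w ∈ W and ⋃_{w ∈ W} V(w) ⊆ V(g). Then for every k-coloring (G, c) of P there exists a guard g' ∈ G that sees at least two distinct points of W, i.e., |V(g') ∩ W| ≥ 2. (Needle Lemma.) -/

import Mathlib

open Set

/-- Points of the plane. -/
abbrev Pt : Type := EuclideanSpace ℝ (Fin 2)

/-- Visibility region of `p` in `P`: points of `P` whose segment to `p` lies in `P`. -/
def Vis (P : Set Pt) (p : Pt) : Set Pt := {q ∈ P | segment ℝ p q ⊆ P}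

/-- `G` is a guard cover of `P`. -/
def GuardCover (P : Set Pt) (G : Finset Pt) : Prop :=
  ↑G ⊆ P ∧ (⋃ g ∈ G, Vis P g) = P

/-- `(G, c)` is a `k`-coloring of `P`: `G` is a guard cover, `c` assigns to each
guard one of `k` colors, and no point of `P` sees two distinct guards of the
same color. -/
def IsColoring (P : Set Pt) (k : ℕ) (G : Finset Pt) (c : Pt → ℕ) : Prop :=
  GuardCover P G ∧ (∀ g ∈ G, c g < k) ∧
    ∀ p ∈ P, ∀ g₁ ∈ G, ∀ g₂ ∈ G, g₁ ≠ g₂ →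
      p ∈ Vis P g₁ → p ∈ Vis P g₂ → c g₁ ≠ c g₂

theorem mem_vis_comm {P : Set Pt} {p q : Pt} (hp : p ∈ P) (h : q ∈ Vis P p) : p ∈ Vis P q :=
  ⟨hp, segment_symm ℝ p q ▸ h.2⟩

/-- **Needle Lemma.** If `k + 1` needle tips `W` are all seen from a common
point `g ∈ P` whose visibility region contains all their visibility regions,
then every `k`-coloring of `P` has a guard seeing at least two points of `W`. -/
theorem needle_lemma (P : Set Pt) (k : ℕ) (hk : 1 ≤ k) (W : Finset Pt)
    (hWP : ↑W ⊆ P) (hWcard : W.card = k + 1)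
    (g : Pt) (hg : g ∈ P) (hsee : ∀ w ∈ W, g ∈ Vis P w)
    (hcov : (⋃ w ∈ W, Vis P w) ⊆ Vis P g)
    (G : Finset Pt) (c : Pt → ℕ) (hcol : IsColoring P k G c) :
    ∃ g' ∈ G, 2 ≤ (Vis P g' ∩ ↑W).ncard := by
  obtain ⟨⟨hGP, hG⟩, hck, hc⟩ := hcol
  have hguard : ∀ w ∈ W, ∃ x ∈ G, w ∈ Vis P x := fun w hw ↦ by
    have hw' := hG.symm ▸ hWP hw
    simpa only [mem_iUnion, exists_prop] using hw'
  choose! f hfG hf using hguard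
  have hgf : ∀ w ∈ W, g ∈ Vis P (f w) := fun w hw ↦
    mem_vis_comm hg (hcov (mem_biUnion hw (mem_vis_comm (hGP (hfG w hw)) (hf w hw))))
  obtain ⟨w₁, hw₁, w₂, hw₂, hne, heq⟩ :=
    Finset.exists_ne_map_eq_of_card_lt_of_maps_to (s := W) (t := Finset.range k)
      (f := fun w ↦ c (f w)) (by simp [hWcard])
      (fun w hw ↦ Finset.mem_coe.2 (Finset.mem_range.2 (hck _ (hfG w hw))))
  have hff : f w₁ = f w₂ := by
    by_contra hfne
    exact hc g hg _ (hfG w₁ hw₁) _ (hfG w₂ hw₂) hfne (hgf w₁ hw₁) (hgf w₂ hw₂) heq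
  refine ⟨f w₁, hfG w₁ hw₁, ?_⟩
  exact (Set.one_lt_ncard_iff (W.finite_toSet.inter_of_right _)).2
    ⟨w₁, w₂, ⟨hf w₁ hw₁, hw₁⟩, ⟨hff ▸ hf w₂ hw₂, hw₂⟩, hne⟩
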